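/- Let B be a strongly abelian algebra and θ a congruence on B such that C(1,1;θ) holds in B. Suppose (p,q,r,s) is a 1,1-matrix of B witnessed as p = t(a,u), q = t(a,v), r = t(b,u), s = t(b,v) with q θ r and ¬(r θ s). Let C be the substructure of B × B generated by the diagonal D = {(z,z) | z ∈ B} together with the pairs (u_j, v_j) for all j, and let γ be the smallest congruence of C containing the pair ((p,q),(r,s)) (note that (p,q) and (r,s) lie in C). Then: (i) D ∩ C is a union of γ-classes, i.e., for all (c,c) ∈ C and (x,y) ∈ C, if ((c,c),(x,y)) ∈ γ then x = y; and (ii) if ((c,c),(d,d)) ∈ γ then c θ d. -/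

import Mathlib

namespace UA

/-- An algebraic language: a type of operation symbols with arities. -/
structure Lang where
  F : Type
  arity : F → ℕ

variable {L : Lang}

/-- An interpretation of the language `L` on the carrier `A` (an algebra structure). -/
def Interp (L : Lang) (A : Type) : Type :=
  (f : L.F) → ((Fin (L.arity f)) → A) → A

/-- Terms of the language `L` over a type `X` of variables. -/
inductive Term (L : Lang) (X : Type) : Type
  | var : X → Term L X
  | app : (f : L.F) → ((Fin (L.arity f)) → Term L X) → Term L X

/-- Realization of a term under an assignment of the variables. -/
def Term.realize {A X : Type} (I : Interp L A) (v : X → A) : Term L X → A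
  | .var x => v x
  | .app f ts => I f (fun i => (ts i).realize I v)

/-- Relabelling (substitution of variables) of terms. -/
def Term.relabel {X Y : Type} (g : X → Y) : Term L X → Term L Y
  | .var x => .var (g x)
  | .app f ts => .app f (fun i => (ts i).relabel g)

/-- `p` is a polynomial operation of the algebra `(A, I)` with argument-index type `X`:
it is the realization of a term in variables `X ⊕ Fin m` where the `Fin m` variables
are evaluated at fixed constants. -/
def IsPolyOp {A X : Type} (I : Interp L A) (p : (X → A) → A) : Prop :=
  ∃ (m : ℕ) (t : Term L (X ⊕ Fin m)) (c : Fin m → A),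
    ∀ x : X → A, p x = t.realize I (Sum.elim x c)

/-- A unary polynomial operation. -/
def IsUnaryPolyOp {A : Type} (I : Interp L A) (g : A → A) : Prop :=
  IsPolyOp I (fun x : Fin 1 → A => g (x 0))

/-- `(p, q, r, s)` is a `1,1`-matrix of the algebra `(A, I)`. -/
def Is11Matrix {A : Type} (I : Interp L A) (p q r s : A) : Prop :=
  ∃ (k l : ℕ) (t : ((Fin k ⊕ Fin l) → A) → A), IsPolyOp I t ∧
    ∃ (a b : Fin k → A) (u v : Fin l → A),
      p = t (Sum.elim a u) ∧ q = t (Sum.elim a v) ∧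
      r = t (Sum.elim b u) ∧ s = t (Sum.elim b v)

/-- The algebra is abelian: in every `1,1`-matrix, `p = q` implies `r = s`. -/
def IsAbelian {A : Type} (I : Interp L A) : Prop :=
  ∀ p q r s : A, Is11Matrix I p q r s → p = q → r = s

/-- The algebra is strongly rectangular: in every `1,1`-matrix, `q = r` implies `r = s`. -/
def IsStronglyRectangular {A : Type} (I : Interp L A) : Prop :=
  ∀ p q r s : A, Is11Matrix I p q r s → q = r → r = s

/-- Strongly abelian = abelian + strongly rectangular. -/
def IsStronglyAbelian {A : Type} (I : Interp L A) : Prop :=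
  IsAbelian I ∧ IsStronglyRectangular I

/-- The algebra has a Maltsev polynomial operation. -/
def HasMaltsevPoly {A : Type} (I : Interp L A) : Prop :=
  ∃ mOp : (Fin 3 → A) → A, IsPolyOp I mOp ∧
    ∀ x y : A, mOp ![x, y, y] = x ∧ mOp ![y, y, x] = x

/-- Affine = abelian + has a Maltsev polynomial operation. -/
def IsAffine {A : Type} (I : Interp L A) : Prop :=
  IsAbelian I ∧ HasMaltsevPoly I

/-- The algebra satisfies the identity `e.1 ≈ e.2`. -/
def Satisfies {A : Type} (I : Interp L A) (e : Term L ℕ × Term L ℕ) : Prop :=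
  ∀ v : ℕ → A, e.1.realize I v = e.2.realize I v

/-- Membership in the variety `Mod(E)` axiomatized by the set `E` of identities. -/
def InVariety {A : Type} (E : Set (Term L ℕ × Term L ℕ)) (I : Interp L A) : Prop :=
  ∀ e ∈ E, Satisfies I e

/-- `θ` is a congruence on the algebra `(A, I)`. -/
def IsCong {A : Type} (I : Interp L A) (θ : A → A → Prop) : Prop :=
  Equivalence θ ∧
    ∀ (f : L.F) (a b : Fin (L.arity f) → A),
      (∀ i, θ (a i) (b i)) → θ (I f a) (I f b)

/-- `(p, q, r, s)` is a `θ`-matrix of the algebra `(A, I)`. -/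
def IsThetaMatrix {A : Type} (I : Interp L A) (θ : A → A → Prop) (p q r s : A) : Prop :=
  ∃ (k l : ℕ) (t : ((Fin k ⊕ Fin l) → A) → A), IsPolyOp I t ∧
    ∃ (a b : Fin k → A) (u v : Fin l → A),
      (∀ i, θ (a i) (b i)) ∧ (∀ j, θ (u j) (v j)) ∧
      p = t (Sum.elim a u) ∧ q = t (Sum.elim a v) ∧
      r = t (Sum.elim b u) ∧ s = t (Sum.elim b v)

/-- `θ` is a strongly abelian congruence. -/
def IsStronglyAbelianCong {A : Type} (I : Interp L A) (θ : A → A → Prop) : Prop :=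
  ∀ p q r s : A, IsThetaMatrix I θ p q r s → (p = q → r = s) ∧ (q = r → r = s)

/-- `S` is a subuniverse of the algebra `(A, I)`. -/
def IsSubuniverse {A : Type} (I : Interp L A) (S : Set A) : Prop :=
  ∀ (f : L.F) (a : Fin (L.arity f) → A), (∀ i, a i ∈ S) → I f a ∈ S

/-- The substructure (restricted algebra structure) on a subuniverse. -/
def subInterp {A : Type} (I : Interp L A) (S : Set A) (hS : IsSubuniverse I S) :
    Interp L S :=
  fun f a => ⟨I f (fun i => (a i : A)), hS f _ (fun i => (a i).2)⟩

/-- The componentwise algebra structure on a product. -/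
def prodInterp {ι : Type} {A : ι → Type} (I : ∀ i, Interp L (A i)) :
    Interp L (∀ i, A i) :=
  fun f a i => I i f (fun j => a j i)

/-- The componentwise algebra structure on `A × A`. -/
def pairInterp {A : Type} (I : Interp L A) : Interp L (A × A) :=
  fun f a => (I f (fun i => (a i).1), I f (fun i => (a i).2))

/-- `h` is a homomorphism of `L`-algebras. -/
def IsHom {A B : Type} (I : Interp L A) (J : Interp L B) (h : A → B) : Prop :=
  ∀ (f : L.F) (a : Fin (L.arity f) → A), h (I f a) = J f (fun i => h (a i))

/-- The induced algebra structure on the quotient by a congruence `ρ`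
(well-defined, i.e. independent of the chosen representatives, when `ρ` is a congruence). -/
noncomputable def quotInterp {A : Type} (I : Interp L A) (ρ : A → A → Prop) :
    Interp L (Quot ρ) :=
  fun f a => Quot.mk ρ (I f (fun i => (a i).out))

/-- The subuniverse generated by a subset `G`: the intersection of all
subuniverses containing `G`. -/
def GenSub {A : Type} (I : Interp L A) (G : Set A) : Set A :=
  {x | ∀ S : Set A, IsSubuniverse I S → G ⊆ S → x ∈ S}

theorem genSub_isSubuniverse {A : Type} (I : Interp L A) (G : Set A) :
    IsSubuniverse I (GenSub I G) :=
  fun f a ha S hS hG => hS f a (fun i => ha i S hS hG)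

/-- The smallest congruence containing the pair `(x, y)`: the intersection of all
congruences containing it. -/
def genCong {A : Type} (I : Interp L A) (x y : A) : A → A → Prop :=
  fun w z => ∀ ρ : A → A → Prop, IsCong I ρ → ρ x y → ρ w z

/-- The carrier of `A(θ)`, the graph of `θ` inside `A × A`. -/
abbrev ThetaSub {A : Type} (θ : A → A → Prop) : Type := {z : A × A // θ z.1 z.2}

/-- The substructure `A(θ) ≤ A × A` supported by the graph of `θ`. -/
def thetaSubInterp {A : Type} (I : Interp L A) (θ : A → A → Prop) (hθ : IsCong I θ) :
    Interp L (ThetaSub θ) :=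
  fun f a => ⟨(I f (fun i => (a i).1.1), I f (fun i => (a i).1.2)),
    hθ.2 f _ _ (fun i => (a i).2)⟩

/-- The diagonal element `(c, c)` of `A(θ)`. -/
def diagEl {A : Type} {θ : A → A → Prop} (hrefl : ∀ a : A, θ a a) (c : A) :
    ThetaSub θ := ⟨(c, c), hrefl c⟩

/-- `Δ`: the smallest congruence of `A(θ)` containing `D × D`, where `D` is the
diagonal -- the intersection of all congruences of `A(θ)` containing `D × D`. -/
def DeltaRel {A : Type} (I : Interp L A) (θ : A → A → Prop) (hθ : IsCong I θ) :
    ThetaSub θ → ThetaSub θ → Prop :=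
  fun x y => ∀ ρ : ThetaSub θ → ThetaSub θ → Prop,
    IsCong (thetaSubInterp I θ hθ) ρ →
    (∀ c d : A, ρ (diagEl hθ.1.refl c) (diagEl hθ.1.refl d)) → ρ x y

/-- The quotient algebra `S = A(θ)/Δ`. -/
noncomputable def SInterp {A : Type} (I : Interp L A) (θ : A → A → Prop)
    (hθ : IsCong I θ) : Interp L (Quot (DeltaRel I θ hθ)) :=
  quotInterp (thetaSubInterp I θ hθ) (DeltaRel I θ hθ)

/-- The element `0` of `S = A(θ)/Δ`: the `Δ`-class of a diagonal element. -/
def zeroS {A : Type} (I : Interp L A) (θ : A → A → Prop) (hθ : IsCong I θ) (d : A) :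
    Quot (DeltaRel I θ hθ) :=
  Quot.mk _ (diagEl hθ.1.refl d)

/-- The diagonal of `B × B`. -/
def diagSet (B : Type) : Set (B × B) := {z | z.1 = z.2}

/-- The set of pairs `(u j, v j)`. -/
def pairsSet {B : Type} {l : ℕ} (u v : Fin l → B) : Set (B × B) :=
  {z | ∃ j, z = (u j, v j)}

/-- The carrier of the subalgebra `C ≤ B × B` generated by the diagonal and the
pairs `(u j, v j)`. -/
def CsetOf {L : Lang} {B : Type} (I : Interp L B) {l : ℕ} (u v : Fin l → B) :
    Set (B × B) :=
  GenSub (pairInterp I) (diagSet B ∪ pairsSet u v)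

/-- The subalgebra `C ≤ B × B` generated by the diagonal and the pairs `(u j, v j)`. -/
def CInterpOf {L : Lang} {B : Type} (I : Interp L B) {l : ℕ} (u v : Fin l → B) :
    Interp L (CsetOf I u v) :=
  subInterp (pairInterp I) _ (genSub_isSubuniverse _ _)


/-- Polynomial operations, described inductively as the clone generated by the projections,
the constants and the basic operations. -/
inductive PolyClone {A X : Type} (I : Interp L A) : ((X → A) → A) → Prop
  | proj (i : X) : PolyClone I (fun x => x i)
  | const (c : A) : PolyClone I (fun _ => c)
  | app (f : L.F) (ps : Fin (L.arity f) → (X → A) → A) (h : ∀ j, PolyClone I (ps j)) :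
      PolyClone I (fun x => I f (fun j => ps j x))

theorem Term.realize_relabel {A X Y : Type} (I : Interp L A) (g : X → Y) (v : Y → A)
    (t : Term L X) : (t.relabel g).realize I v = t.realize I (v ∘ g) := by
  induction t with
  | var x => rfl
  | app f ts ih => simp only [Term.relabel, Term.realize, ih]

theorem PolyClone.comp {A X Y : Type} {I : Interp L A} {p : (Y → A) → A}
    (hp : PolyClone I p) {w : Y → (X → A) → A} (hw : ∀ y, PolyClone I (w y)) :
    PolyClone I (fun x => p (fun y => w y x)) := by
  induction hp with
  | proj i => exact hw i
  | const c => exact .const c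
  | app f ps _ ih => exact .app f (fun j x => ps j (fun y => w y x)) ih

theorem PolyClone.map_rel {A X : Type} {I : Interp L A} {p : (X → A) → A}
    (hp : PolyClone I p) {θ : A → A → Prop} (hθ : IsCong I θ) {x y : X → A}
    (h : ∀ i, θ (x i) (y i)) : θ (p x) (p y) := by
  induction hp with
  | proj i => exact h i
  | const c => exact hθ.1.refl c
  | app f ps _ ih => exact hθ.2 f _ _ ih

theorem IsPolyOp.polyClone {A X : Type} {I : Interp L A} {p : (X → A) → A}
    (hp : IsPolyOp I p) : PolyClone I p := by
  obtain ⟨m, t, c, h⟩ := hp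
  obtain rfl : p = fun x => t.realize I (Sum.elim x c) := funext h
  clear h
  induction t with
  | var x =>
    cases x with
    | inl i => exact .proj i
    | inr j => exact .const (c j)
  | app f ts ih => exact .app f (fun j x => (ts j).realize I (Sum.elim x c)) ih

theorem PolyClone.isPolyOp {A X : Type} {I : Interp L A} {p : (X → A) → A}
    (hp : PolyClone I p) : IsPolyOp I p := by
  induction hp with
  | proj i => exact ⟨0, .var (.inl i), Fin.elim0, fun _ => rfl⟩
  | const c => exact ⟨1, .var (.inr 0), fun _ => c, fun _ => rfl⟩
  | app f ps _ ih =>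
    choose m t c h using ih
    let e := Fintype.equivFin (Σ j, Fin (m j))
    refine ⟨_, .app f (fun j => (t j).relabel (Sum.map id (fun i => e ⟨j, i⟩))),
      fun i => c (e.symm i).1 (e.symm i).2, fun x => ?_⟩
    simp only [Term.realize, Term.realize_relabel, h]
    congr 1
    funext j
    congr 1
    funext z
    rcases z with z | i
    · rfl
    · change c j i = c (e.symm (e ⟨j, i⟩)).1 (e.symm (e ⟨j, i⟩)).2
      rw [e.symm_apply_apply]

/-- Every element of the generated subalgebra is a polynomial evaluated at `u` and at `v`. -/
theorem exists_polyClone_of_mem_CsetOf {B : Type} {I : Interp L B} {l : ℕ} {u v : Fin l → B}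
    {z : B × B} (hz : z ∈ CsetOf I u v) :
    ∃ W : (Fin l → B) → B, PolyClone I W ∧ z.1 = W u ∧ z.2 = W v := by
  refine hz {z | ∃ W : (Fin l → B) → B, PolyClone I W ∧ z.1 = W u ∧ z.2 = W v} ?_ ?_
  · intro f a ha
    choose W hW h1 h2 using ha
    exact ⟨_, .app f W hW, congrArg (I f) (funext h1), congrArg (I f) (funext h2)⟩
  · rintro ⟨x, y⟩ (h | ⟨j, h⟩)
    · exact ⟨_, .const x, rfl, Eq.symm h⟩
    · obtain ⟨rfl, rfl⟩ := Prod.mk.inj h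
      exact ⟨_, .proj j, rfl, rfl⟩

/-- Compatibility with the basic operations can be checked one argument at a time. -/
theorem isCong_of_update {A : Type} {J : Interp L A} {ρ : A → A → Prop} (hρ : Equivalence ρ)
    (h : ∀ (f : L.F) (w : Fin (L.arity f) → A) (i : Fin (L.arity f)) (x y : A),
      ρ x y → ρ (J f (Function.update w i x)) (J f (Function.update w i y))) :
    IsCong J ρ := by
  refine ⟨hρ, fun f a b hab => ?_⟩
  have key : ∀ S : Finset (Fin (L.arity f)), ρ (J f a) (J f (S.piecewise b a)) := by
    intro S
    induction S using Finset.induction_on with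
    | empty => simpa using hρ.refl _
    | insert j S hj ih =>
      refine hρ.trans ih ?_
      have := h f (S.piecewise b a) j _ _ (hab j)
      rw [Finset.piecewise_insert]
      rwa [Function.update_eq_self_iff.2 (by simp [hj])] at this
  simpa using key Finset.univ

/-- Two pairs agree on being diagonal, and have `θ`-related first entries if they are. -/
def DiagCompat {B : Type} (θ : B → B → Prop) (z w : B × B) : Prop :=
  (z.1 = z.2 ↔ w.1 = w.2) ∧ (z.1 = z.2 → θ z.1 w.1)

theorem DiagCompat.equivalence {B : Type} {θ : B → B → Prop} (hθ : Equivalence θ) :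
    Equivalence (DiagCompat θ) where
  refl _ := ⟨Iff.rfl, fun _ => hθ.refl _⟩
  symm h := ⟨h.1.symm, fun hw => hθ.symm (h.2 (h.1.2 hw))⟩
  trans h h' := ⟨h.1.trans h'.1, fun hz => hθ.trans (h.2 hz) (h'.2 (h.1.1 hz))⟩

/-- Evaluation at `z` of the unary polynomial of the subalgebra induced by `g`. -/
def translate {B : Type} {l : ℕ} (u v : Fin l → B) (g : (Fin 1 ⊕ Fin l → B) → B)
    (z : B × B) : B × B :=
  (g (Sum.elim (fun _ => z.1) u), g (Sum.elim (fun _ => z.2) v))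

/-- The largest congruence of the subalgebra contained in `DiagCompat θ`. -/
def diagCong {B : Type} (I : Interp L B) (θ : B → B → Prop) {l : ℕ} (u v : Fin l → B)
    (z w : CsetOf I u v) : Prop :=
  ∀ g, PolyClone I g → DiagCompat θ (translate u v g z) (translate u v g w)

theorem diagCong_isCong {B : Type} (I : Interp L B) {θ : B → B → Prop} (hθ : Equivalence θ)
    {l : ℕ} (u v : Fin l → B) : IsCong (CInterpOf I u v) (diagCong I θ u v) := by
  have hP := DiagCompat.equivalence hθ
  refine isCong_of_update ⟨fun _ _ _ => hP.refl _, fun h g hg => hP.symm (h g hg),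
    fun h h' g hg => hP.trans (h g hg) (h' g hg)⟩ ?_
  intro f w i x y hxy g hg
  choose W hW h1 h2 using fun j => exists_polyClone_of_mem_CsetOf (w j).2
  let ops : Fin (L.arity f) → (Fin 1 ⊕ Fin l → B) → B :=
    Function.update (fun j x => W j (fun m => x (.inr m))) i (fun x => x (.inl 0))
  have hops : ∀ j, PolyClone I (ops j) := by
    intro j
    by_cases hj : j = i
    · subst hj
      simpa [ops] using PolyClone.proj (I := I) (X := Fin 1 ⊕ Fin l) (.inl 0)
    · simpa [ops, hj] using (hW j).comp (fun m => PolyClone.proj (X := Fin 1 ⊕ Fin l) (.inr m))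
  let args : (Fin 1 ⊕ Fin l) → (Fin 1 ⊕ Fin l → B) → B :=
    Sum.elim (fun _ x => I f (fun j => ops j x)) (fun m x => x (.inr m))
  have hargs : ∀ y, PolyClone I (args y) := by
    rintro (_ | m)
    · exact .app f ops hops
    · exact .proj _
  have key : ∀ z : CsetOf I u v,
      translate u v g (CInterpOf I u v f (Function.update w i z) : CsetOf I u v) =
        translate u v (fun x => g (fun y => args y x)) z := by
    intro z
    refine Prod.ext (congrArg g ?_) (congrArg g ?_) <;>
    · funext m
      rcases m with m | m
      · refine congrArg (I f) (funext fun j => ?_)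
        by_cases hj : j = i
        · subst hj
          simp [ops]
        · simp [ops, hj, h1, h2]
      · rfl
  rw [key, key]
  exact hxy _ (hg.comp hargs)

theorem diagCong_of_matrix {B : Type} {I : Interp L B} (hB : IsStronglyAbelian I)
    {θ : B → B → Prop} (hθ : IsCong I θ)
    (hC11 : ∀ p q r s : B, Is11Matrix I p q r s → θ p q → θ r s)
    {k l : ℕ} {t : (Fin k ⊕ Fin l → B) → B} (ht : IsPolyOp I t)
    (a b : Fin k → B) (u v : Fin l → B)
    (hqr : θ (t (Sum.elim a v)) (t (Sum.elim b u)))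
    (z w : CsetOf I u v) (hz : (z : B × B) = (t (Sum.elim a u), t (Sum.elim a v)))
    (hw : (w : B × B) = (t (Sum.elim b u), t (Sum.elim b v))) :
    diagCong I θ u v z w := by
  intro g hg
  let args : (Fin 1 ⊕ Fin l) → (Fin k ⊕ Fin l → B) → B :=
    Sum.elim (fun _ => t) (fun m x => x (.inr m))
  have hargs : ∀ y, PolyClone I (args y) := by
    rintro (_ | m)
    · exact ht.polyClone
    · exact .proj _
  have hh := (hg.comp hargs).isPolyOp
  have eval : ∀ (x : Fin k → B) (y : Fin l → B),
      g (Sum.elim (fun _ => t (Sum.elim x y)) y) = g (fun m => args m (Sum.elim x y)) := by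
    intro x y
    refine congrArg g (funext fun m => ?_)
    rcases m with m | m <;> rfl
  have abelian : ∀ a b : Fin k → B,
      g (Sum.elim (fun _ => t (Sum.elim a u)) u) = g (Sum.elim (fun _ => t (Sum.elim a v)) v) →
      g (Sum.elim (fun _ => t (Sum.elim b u)) u) = g (Sum.elim (fun _ => t (Sum.elim b v)) v) := by
    intro a b
    exact hB.1 _ _ _ _ ⟨k, l, _, hh, a, b, u, v, eval _ _, eval _ _, eval _ _, eval _ _⟩
  rw [hz, hw]
  refine ⟨⟨abelian a b, abelian b a⟩, fun h => ?_⟩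
  simp only [translate] at h ⊢
  have hpp : g (Sum.elim (fun _ => t (Sum.elim a u)) u) =
      g (Sum.elim (fun _ => t (Sum.elim a u)) v) :=
    hB.2 _ _ _ _ ⟨1, l, g, hg.isPolyOp, fun _ => t (Sum.elim a v), fun _ => t (Sum.elim a u),
      u, v, rfl, rfl, rfl, rfl⟩ h.symm
  have hrr : θ (g (Sum.elim (fun _ => t (Sum.elim b u)) u))
      (g (Sum.elim (fun _ => t (Sum.elim b u)) v)) :=
    hC11 _ _ _ _ ⟨1, l, g, hg.isPolyOp, fun _ => t (Sum.elim a u), fun _ => t (Sum.elim b u),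
      u, v, rfl, rfl, rfl, rfl⟩ (hpp ▸ hθ.1.refl _)
  have hqv : θ (g (Sum.elim (fun _ => t (Sum.elim a v)) v))
      (g (Sum.elim (fun _ => t (Sum.elim b u)) v)) := by
    refine hg.map_rel hθ fun m => ?_
    rcases m with m | m
    · exact hqr
    · exact hθ.1.refl _
  rw [h]
  exact hθ.1.trans hqv (hθ.1.symm hrr)

/-- Let `B` be strongly abelian, `θ` a congruence with `C(1,1;θ)`, and
`(p,q,r,s)` a witnessed `1,1`-matrix with `q θ r` and `¬(r θ s)`. Let `C ≤ B × B` be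
generated by the diagonal and the pairs `(u j, v j)`, and `γ` the smallest congruence of
`C` containing `((p,q),(r,s))`. Then (i) the diagonal of `C` is a union of `γ`-classes,
and (ii) `γ`-related diagonal elements `((c,c),(d,d))` satisfy `c θ d`. -/
theorem statement14 {L : Lang} {B : Type} (I : Interp L B)
    (hB : IsStronglyAbelian I)
    (θ : B → B → Prop) (hθ : IsCong I θ)
    (hC11 : ∀ p q r s : B, Is11Matrix I p q r s → θ p q → θ r s)
    {k l : ℕ} (t : ((Fin k ⊕ Fin l) → B) → B) (ht : IsPolyOp I t)
    (a b : Fin k → B) (u v : Fin l → B)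
    (p q r s : B)
    (hp : p = t (Sum.elim a u)) (hq : q = t (Sum.elim a v))
    (hr : r = t (Sum.elim b u)) (hs : s = t (Sum.elim b v))
    (hqr : θ q r) (hrs : ¬ θ r s)
    (hpq : ((p, q) : B × B) ∈ CsetOf I u v)
    (hrsm : ((r, s) : B × B) ∈ CsetOf I u v) :
    (∀ (c : B) (hc : ((c, c) : B × B) ∈ CsetOf I u v) (w : CsetOf I u v),
      genCong (CInterpOf I u v) ⟨(p, q), hpq⟩ ⟨(r, s), hrsm⟩ ⟨(c, c), hc⟩ w →
      (w : B × B).1 = (w : B × B).2) ∧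
    (∀ (c d : B) (hc : ((c, c) : B × B) ∈ CsetOf I u v)
      (hd : ((d, d) : B × B) ∈ CsetOf I u v),
      genCong (CInterpOf I u v) ⟨(p, q), hpq⟩ ⟨(r, s), hrsm⟩ ⟨(c, c), hc⟩ ⟨(d, d), hd⟩ →
      θ c d) := by
  subst hp hq hr hs
  have key : ∀ z w : CsetOf I u v, genCong (CInterpOf I u v) ⟨_, hpq⟩ ⟨_, hrsm⟩ z w →
      DiagCompat θ (z : B × B) (w : B × B) := fun z w h =>
    h _ (diagCong_isCong I hθ.1 u v)
      (diagCong_of_matrix hB hθ hC11 ht a b u v hqr _ _ rfl rfl) (fun x => x (.inl 0)) (.proj _)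
  exact ⟨fun c hc w h => (key _ _ h).1.1 rfl, fun c d hc hd h => (key _ _ h).2 rfl⟩

end UA
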